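/- arXiv:math/0204210 — 3 statements merged into one kernel-verified Lean document; each statement's English description precedes it below -/
import Mathlib

section
/- Let n ≥ 1, let R be a commutative ring containing an element ζ that is a root of the n-th cyclotomic polynomial Φ_n over ℤ, let G be a cyclic group of order n with fixed generator τ, and let M be a finite R[G]-module. Then [M] = ∏_{i=0}^{n-1} [ε_{χ^i}M] · ∏_{i=0}^{n-1} [S_{χ^i}(M)]. -/
noncomputable section

open Polynomial

variable {R : Type*} [CommRing R] {M : Type*} [AddCommGroup M] [Module R M]

/-- The isotypic component `M^{χ^i} = {m : τ m = ζ^i m}` of the module `M`, where the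
generator `τ` of the cyclic group acts via the `R`-linear endomorphism `T` and
`ζ` is the chosen root of unity. -/
def isoComp (T : Module.End R M) (ζ : R) (i : ℕ) : Submodule R M :=
  LinearMap.ker (T - ζ ^ i • (1 : Module.End R M))

/-- The quasi-idempotent `ε_{χ^i} = ∑_{j<n} ζ^{-ij} τ^j`, acting on `M`.  Here
`ζ⁻¹ = ζ^{n-1}` since `ζ^n = 1`. -/
def quasiIdem (T : Module.End R M) (ζ : R) (n i : ℕ) : Module.End R M :=
  ∑ j ∈ Finset.range n, ζ ^ ((n - 1) * (i * j)) • T ^ j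

/-- The product `P_i = ∏_{j=i+1}^{n-1} (τ - ζ^j)`, acting on `M`. -/
def tailProd (T : Module.End R M) (ζ : R) (n i : ℕ) : Module.End R M :=
  Polynomial.aeval T (∏ j ∈ Finset.Ico (i + 1) n, (X - C (ζ ^ j)))

/-- `Ĥ⁰_{χ^i}(G, M) = M^{χ^i} / ε_{χ^i} M`. -/
abbrev H0chi (T : Module.End R M) (ζ : R) (n i : ℕ) :=
  ↥(isoComp T ζ i) ⧸
    Submodule.comap (isoComp T ζ i).subtype (LinearMap.range (quasiIdem T ζ n i))

/-- `S_{χ^i}(M) = (M^{χ^i} ∩ P_i M) / ε_{χ^i} M`, a submodule of `Ĥ⁰_{χ^i}(G, M)`. -/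
def Schi (T : Module.End R M) (ζ : R) (n i : ℕ) : Submodule R (H0chi T ζ n i) :=
  Submodule.map
    (Submodule.mkQ
      (Submodule.comap (isoComp T ζ i).subtype (LinearMap.range (quasiIdem T ζ n i))))
    (Submodule.comap (isoComp T ζ i).subtype (LinearMap.range (tailProd T ζ n i)))


/-- An integral polynomial identity in a primitive complex `n`-th root of unity holds for every
root of the `n`-th cyclotomic polynomial in a commutative ring. -/
theorem map_aeval_eq_zero_of_aeval_cyclotomic {n : ℕ} (hn : 0 < n) {R : Type*} [CommRing R]
    {ζ : R} (hζ : aeval ζ (cyclotomic n ℤ) = 0) {z : ℂ} (hz : IsPrimitiveRoot z n)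
    {F : ℤ[X][X]} (hF : F.map (aeval z : ℤ[X] →ₐ[ℤ] ℂ).toRingHom = 0) :
    F.map (aeval ζ : ℤ[X] →ₐ[ℤ] R).toRingHom = 0 := by
  ext k
  have h : aeval z (F.coeff k) = 0 := by simpa using congrArg (fun p => p.coeff k) hF
  have hdvd : cyclotomic n ℤ ∣ F.coeff k := by
    rw [cyclotomic_eq_minpoly hz hn]
    exact minpoly.isIntegrallyClosed_dvd (hz.isIntegral hn) h
  obtain ⟨q, hq⟩ := hdvd
  simp [hq, hζ]

theorem prod_X_sub_C_pow_of_aeval_cyclotomic {n : ℕ} (hn : 0 < n) {R : Type*} [CommRing R]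
    {ζ : R} (hζ : aeval ζ (cyclotomic n ℤ) = 0) :
    ∏ j ∈ Finset.range n, (X - C (ζ ^ j)) = (X ^ n - 1 : R[X]) := by
  have hz := Complex.isPrimitiveRoot_exp n hn.ne'
  set z := Complex.exp (2 * Real.pi * Complex.I / n)
  have hC : ∏ j ∈ Finset.range n, (X - C (z ^ j)) = (X ^ n - 1 : ℂ[X]) := by
    simpa using (X_pow_sub_C_eq_prod hz hn (one_pow n)).symm
  have key := map_aeval_eq_zero_of_aeval_cyclotomic hn hζ hz
    (F := ∏ j ∈ Finset.range n, (X - C (X ^ j)) - (X ^ n - 1))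
    (by simpa [Polynomial.map_prod, sub_eq_zero] using hC)
  simpa [Polynomial.map_prod, sub_eq_zero] using key

theorem pow_eq_one_of_aeval_cyclotomic {n : ℕ} {R : Type*} [CommRing R]
    {ζ : R} (hζ : aeval ζ (cyclotomic n ℤ) = 0) : ζ ^ n = 1 := by
  obtain ⟨q, hq⟩ := cyclotomic.dvd_X_pow_sub_one n ℤ
  simpa [hζ, sub_eq_zero] using congrArg (aeval ζ) hq

/-- The polynomial whose value at `T` is `quasiIdem T ζ n i`. -/
def quasiIdemPoly {R : Type*} [CommRing R] (ζ : R) (n i : ℕ) : R[X] :=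
  ∑ j ∈ Finset.range n, C (ζ ^ ((n - 1) * (i * j))) * X ^ j

theorem aeval_quasiIdemPoly {R : Type*} [CommRing R] {M : Type*} [AddCommGroup M] [Module R M]
    (T : Module.End R M) (ζ : R) (n i : ℕ) :
    aeval T (quasiIdemPoly ζ n i) = quasiIdem T ζ n i := by
  simp [quasiIdemPoly, quasiIdem, Algebra.smul_def]

theorem X_sub_C_mul_quasiIdemPoly {R : Type*} [CommRing R] {ζ : R} {n : ℕ} (hn : 0 < n)
    (hζ : ζ ^ n = 1) (i : ℕ) :
    (X - C (ζ ^ i)) * quasiIdemPoly ζ n i = C (ζ ^ i) * (X ^ n - 1) := by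
  have hinv : ζ ^ i * ζ ^ ((n - 1) * i) = 1 := by
    rw [← pow_add, add_comm, ← Nat.succ_mul, Nat.succ_eq_add_one, Nat.sub_add_cancel hn, pow_mul,
      hζ, one_pow]
  have hsum : quasiIdemPoly ζ n i =
      ∑ j ∈ Finset.range n, (C (ζ ^ ((n - 1) * i)) * X) ^ j := by
    refine Finset.sum_congr rfl fun j _ => ?_
    rw [mul_pow, ← C_pow, ← pow_mul, mul_assoc]
  have hpow : (C (ζ ^ ((n - 1) * i)) * X) ^ n = (X ^ n : R[X]) := by
    rw [mul_pow, ← C_pow, ← pow_mul, mul_comm _ n, pow_mul, hζ, one_pow, C_1, one_mul]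
  have hfac : (X - C (ζ ^ i) : R[X]) = C (ζ ^ i) * (C (ζ ^ ((n - 1) * i)) * X - 1) := by
    rw [mul_sub, ← mul_assoc, ← C_mul, hinv, C_1, one_mul, mul_one]
  rw [hfac, hsum, mul_assoc, mul_geom_sum, hpow]

theorem quasiIdemPoly_eq_prod_mul {R : Type*} [CommRing R] {ζ : R} {n i : ℕ}
    (hζ : aeval ζ (cyclotomic n ℤ) = 0) (hi : i < n) :
    quasiIdemPoly ζ n i =
      (∏ j ∈ Finset.Ico (i + 1) n, (X - C (ζ ^ j))) *
        (C (ζ ^ i) * ∏ j ∈ Finset.range i, (X - C (ζ ^ j))) := by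
  have hn : 0 < n := by lia
  apply (monic_X_sub_C (ζ ^ i)).isRegular.left
  change (X - C (ζ ^ i)) * _ = (X - C (ζ ^ i)) * _
  rw [X_sub_C_mul_quasiIdemPoly hn (pow_eq_one_of_aeval_cyclotomic hζ),
    ← prod_X_sub_C_pow_of_aeval_cyclotomic hn hζ, ← Finset.prod_range_mul_prod_Ico _ hi,
    Finset.prod_range_succ]
  ring

theorem range_quasiIdem_le_isoComp {R : Type*} [CommRing R] {M : Type*} [AddCommGroup M]
    [Module R M] {T : Module.End R M} {ζ : R} {n : ℕ} (hn : 0 < n) (hζ : ζ ^ n = 1)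
    (hT : T ^ n = 1) (i : ℕ) :
    LinearMap.range (quasiIdem T ζ n i) ≤ isoComp T ζ i := by
  refine LinearMap.range_le_ker_iff.mpr ?_
  have h := congrArg (aeval T) (X_sub_C_mul_quasiIdemPoly hn hζ i)
  rw [← Module.End.mul_eq_comp]
  simpa [aeval_quasiIdemPoly, map_pow (aeval T), hT, Algebra.algebraMap_eq_smul_one, -map_pow]
    using h

theorem range_quasiIdem_le_range_tailProd {R : Type*} [CommRing R] {M : Type*} [AddCommGroup M]
    [Module R M] (T : Module.End R M) {ζ : R} {n i : ℕ}
    (hζ : aeval ζ (cyclotomic n ℤ) = 0) (hi : i < n) :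
    LinearMap.range (quasiIdem T ζ n i) ≤ LinearMap.range (tailProd T ζ n i) := by
  rw [← aeval_quasiIdemPoly, quasiIdemPoly_eq_prod_mul hζ hi, map_mul]
  exact LinearMap.range_comp_le_range _ _

theorem Submodule.card_comap_subtype {R V : Type*} [Ring R] [AddCommGroup V] [Module R V]
    (L N : Submodule R V) : Nat.card (N.comap L.subtype) = Nat.card ↥(L ⊓ N) := by
  rw [← Submodule.map_comap_subtype]
  exact Nat.card_congr (Submodule.equivSubtypeMap _ _).toEquiv

theorem Submodule.card_eq_card_map_mul_card_inf_ker {R V W : Type*} [Ring R] [AddCommGroup V]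
    [AddCommGroup W] [Module R V] [Module R W] (f : V →ₗ[R] W) (L : Submodule R V) :
    Nat.card L = Nat.card (L.map f) * Nat.card ↥(L ⊓ LinearMap.ker f) := by
  rw [Submodule.card_eq_card_quotient_mul_card (LinearMap.ker (f.domRestrict L)),
    Nat.card_congr (f.domRestrict L).quotKerEquivRange.toEquiv, LinearMap.range_domRestrict,
    LinearMap.ker_domRestrict, mul_comm, ← Submodule.card_comap_subtype]

theorem card_isoComp_inf_range_tailProd {R : Type*} [CommRing R] {M : Type*} [AddCommGroup M]
    [Module R M] {T : Module.End R M} {ζ : R} {n i : ℕ}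
    (hζ : aeval ζ (cyclotomic n ℤ) = 0) (hT : T ^ n = 1) (hi : i < n) :
    Nat.card ↥(isoComp T ζ i ⊓ LinearMap.range (tailProd T ζ n i)) =
      Nat.card (LinearMap.range (quasiIdem T ζ n i)) * Nat.card (Schi T ζ n i) := by
  have hiso := range_quasiIdem_le_isoComp (by lia) (pow_eq_one_of_aeval_cyclotomic hζ) hT i
  have hle := range_quasiIdem_le_range_tailProd T hζ hi
  have h := Submodule.card_eq_card_map_mul_card_inf_ker
    (Submodule.mkQ ((LinearMap.range (quasiIdem T ζ n i)).comap (isoComp T ζ i).subtype))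
    ((LinearMap.range (tailProd T ζ n i)).comap (isoComp T ζ i).subtype)
  rw [Submodule.ker_mkQ, inf_eq_right.mpr (Submodule.comap_mono hle),
    Submodule.card_comap_subtype, Submodule.card_comap_subtype, inf_eq_right.mpr hiso, mul_comm] at h
  exact h

theorem card_range_tailProd {R : Type*} [CommRing R] {M : Type*} [AddCommGroup M]
    [Module R M] (T : Module.End R M) (ζ : R) {n i : ℕ} (hi : i < n) :
    Nat.card (LinearMap.range (tailProd T ζ n i)) =
      Nat.card (LinearMap.range (aeval T (∏ j ∈ Finset.Ico i n, (X - C (ζ ^ j))))) *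
        Nat.card ↥(isoComp T ζ i ⊓ LinearMap.range (tailProd T ζ n i)) := by
  have hmap : (LinearMap.range (tailProd T ζ n i)).map (T - ζ ^ i • (1 : Module.End R M)) =
      LinearMap.range (aeval T (∏ j ∈ Finset.Ico i n, (X - C (ζ ^ j)))) := by
    rw [← LinearMap.range_comp, Finset.prod_eq_prod_Ico_succ_bot hi, map_mul]
    simp [tailProd, Algebra.algebraMap_eq_smul_one, Module.End.mul_eq_comp, -map_pow]
  rw [Submodule.card_eq_card_map_mul_card_inf_ker (T - ζ ^ i • (1 : Module.End R M)), hmap,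
    inf_comm]
  rfl

/-- **Theorem 0.2 / 2.2 (second form).** For a cyclic group `G` of order `n` with generator
`τ` (encoded as an `R`-linear endomorphism `T` of `M` with `T^n = 1`), a commutative ring `R`
containing a root `ζ` of the `n`-th cyclotomic polynomial, and a finite `R[G]`-module `M`:
`[M] = ∏_i [ε_{χ^i} M] ⬝ ∏_i [S_{χ^i}(M)]`. -/
theorem order_eq_prod_quasiIdem_mul_prod_S
    (n : ℕ) (hn : 1 ≤ n) (R : Type*) [CommRing R] (ζ : R)
    (hζ : Polynomial.aeval ζ (Polynomial.cyclotomic n ℤ) = 0)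
    (M : Type*) [AddCommGroup M] [Module R M] [Finite M]
    (T : Module.End R M) (hT : T ^ n = 1) :
    Nat.card M =
      (∏ i ∈ Finset.range n, Nat.card (LinearMap.range (quasiIdem T ζ n i))) *
        ∏ i ∈ Finset.range n, Nat.card (Schi T ζ n i) := by
  have hrange (k : ℕ) (hk : k ≤ n) :
      Nat.card (LinearMap.range (aeval T (∏ j ∈ Finset.Ico k n, (X - C (ζ ^ j))))) =
        ∏ i ∈ Finset.range k,
          (Nat.card (LinearMap.range (quasiIdem T ζ n i)) * Nat.card (Schi T ζ n i)) := by
    induction k with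
    | zero =>
      rw [← Finset.range_eq_Ico, prod_X_sub_C_pow_of_aeval_cyclotomic hn hζ]
      simp [hT]
    | succ k ih =>
      rw [Finset.prod_range_succ, ← ih (by lia), ← card_isoComp_inf_range_tailProd hζ hT hk,
        ← card_range_tailProd T ζ hk, tailProd]
  rw [← Finset.prod_mul_distrib, ← hrange n le_rfl]
  simp [Module.End.one_eq_id, LinearMap.range_id]
end
end

section
/- Let n ≥ 1, let R be a commutative ring containing an element ζ that is a root of the n-th cyclotomic polynomial Φ_n over ℤ, let G be a cyclic group of order n with fixed generator τ, and let M be a finite R[G]-module which has no n-torsion (i.e., n·m = 0 implies m = 0 for m ∈ M). Then Ĥ⁰_{χ^i}(G,M) = 0 for every 0 ≤ i ≤ n-1, and [M] = ∏_{i=0}^{n-1} [M^{χ^i}] = ∏_{i=0}^{n-1} [ε_{χ^i}M]. -/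
noncomputable section

open Polynomial

variable {R : Type*} [CommRing R] {M : Type*} [AddCommGroup M] [Module R M]

/-- A root of `Φ_n` in a commutative ring is an `n`-th root of unity. -/
theorem pow_eq_one_of_aeval_cyclotomic_eq_zero {A : Type*} [CommRing A] {ζ : A} {n : ℕ}
    (hζ : aeval ζ (cyclotomic n ℤ) = 0) : ζ ^ n = 1 := by
  obtain ⟨q, hq⟩ := cyclotomic.dvd_X_pow_sub_one n ℤ
  have h := congrArg (aeval ζ) hq
  rw [map_mul, hζ, zero_mul] at h
  simpa [sub_eq_zero] using h

/-- Orthogonality of characters for a root of `Φ_n` in a commutative ring. -/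
theorem geom_sum_eq_zero_of_aeval_cyclotomic_eq_zero {A : Type*} [CommRing A] {ζ : A} {n a : ℕ}
    (hn : 0 < n) (hζ : aeval ζ (cyclotomic n ℤ) = 0) (ha : ¬ n ∣ a) :
    ∑ k ∈ Finset.range n, (ζ ^ a) ^ k = 0 := by
  have hω := Complex.isPrimitiveRoot_exp n hn.ne'
  set ω := Complex.exp (2 * Real.pi * Complex.I / n)
  have hne : ω ^ a ≠ 1 := fun h => ha (hω.dvd_of_pow_eq_one a h)
  have hsum : aeval ω (∑ k ∈ Finset.range n, ((X : ℤ[X]) ^ a) ^ k) = 0 := by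
    have h := mul_geom_sum (ω ^ a) n
    rw [← pow_mul, mul_comm a n, pow_mul, hω.pow_eq_one, one_pow, sub_self] at h
    simpa using (mul_eq_zero.mp h).resolve_left (sub_ne_zero.mpr hne)
  have hdvd := minpoly.isIntegrallyClosed_dvd (hω.isIntegral hn) hsum
  rw [← cyclotomic_eq_minpoly hω hn] at hdvd
  obtain ⟨q, hq⟩ := hdvd
  have h := congrArg (aeval ζ) hq
  rw [map_mul, hζ, zero_mul] at h
  simpa using h

theorem mem_isoComp {T : Module.End R M} {ζ : R} {i : ℕ} {m : M} :
    m ∈ isoComp T ζ i ↔ T m = ζ ^ i • m := by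
  simp [isoComp, LinearMap.mem_ker, sub_eq_zero]

theorem quasiIdem_eq_geom_sum (T : Module.End R M) (ζ : R) (n i : ℕ) :
    quasiIdem T ζ n i = ∑ j ∈ Finset.range n, (ζ ^ ((n - 1) * i) • T) ^ j := by
  refine Finset.sum_congr rfl fun j _ => ?_
  rw [_root_.smul_pow, ← pow_mul, mul_assoc]

theorem quasiIdem_apply_mem_isoComp {T : Module.End R M} {ζ : R} {n : ℕ} (hn : 0 < n)
    (hζ : ζ ^ n = 1) (hT : T ^ n = 1) (i : ℕ) (m : M) :
    quasiIdem T ζ n i m ∈ isoComp T ζ i := by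
  have hgeom := mul_geom_sum (ζ ^ ((n - 1) * i) • T) n
  rw [← quasiIdem_eq_geom_sum, _root_.smul_pow, hT, pow_right_comm, hζ, one_pow,
    one_smul, sub_self, sub_mul, one_mul, sub_eq_zero] at hgeom
  have hm := congrArg (fun f : Module.End R M => ζ ^ i • f m) hgeom
  have hinv : ζ ^ i * ζ ^ ((n - 1) * i) = 1 := by
    rw [← pow_add, show i + (n - 1) * i = n * i by
      obtain ⟨k, rfl⟩ := Nat.exists_eq_succ_of_ne_zero hn.ne'
      simp; ring, pow_mul, hζ, one_pow]
  rw [mem_isoComp]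
  simpa [smul_smul, hinv] using hm

theorem pow_apply_of_mem_isoComp {T : Module.End R M} {ζ : R} {i : ℕ} {m : M}
    (hm : m ∈ isoComp T ζ i) (k : ℕ) : (T ^ k) m = ζ ^ (i * k) • m := by
  induction k with
  | zero => simp
  | succ k ih =>
    rw [pow_succ', Module.End.mul_apply, ih, map_smul, mem_isoComp.mp hm, smul_smul, ← pow_add,
      mul_add, mul_one]

theorem quasiIdem_apply_of_mem_isoComp {T : Module.End R M} {ζ : R} {n j : ℕ} {m : M}
    (hm : m ∈ isoComp T ζ j) (i : ℕ) :
    quasiIdem T ζ n i m = (∑ k ∈ Finset.range n, (ζ ^ ((n - 1) * i + j)) ^ k) • m := by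
  rw [quasiIdem, LinearMap.sum_apply, Finset.sum_smul]
  refine Finset.sum_congr rfl fun k _ => ?_
  rw [LinearMap.smul_apply, pow_apply_of_mem_isoComp hm, smul_smul, ← pow_add, ← pow_mul]
  congr 2
  ring

theorem quasiIdem_apply_of_mem_isoComp_self {T : Module.End R M} {ζ : R} {n i : ℕ} {m : M}
    (hn : 0 < n) (hζ : ζ ^ n = 1) (hm : m ∈ isoComp T ζ i) :
    quasiIdem T ζ n i m = n • m := by
  have h : (n - 1) * i + i = n * i := by
    obtain ⟨k, rfl⟩ := Nat.exists_eq_succ_of_ne_zero hn.ne'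
    simp; ring
  rw [quasiIdem_apply_of_mem_isoComp hm, h, pow_mul, hζ]
  simp [Nat.cast_smul_eq_nsmul]

theorem quasiIdem_apply_of_mem_isoComp_of_ne {T : Module.End R M} {ζ : R} {n i j : ℕ} {m : M}
    (hζ : aeval ζ (cyclotomic n ℤ) = 0) (hi : i < n) (hj : j < n) (hij : i ≠ j)
    (hm : m ∈ isoComp T ζ j) : quasiIdem T ζ n i m = 0 := by
  have hn : 0 < n := by omega
  have hndvd : ¬ n ∣ (n - 1) * i + j := by
    intro h
    have hz : (n : ℤ) ∣ (n - 1) * i + j := by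
      have := Int.natCast_dvd_natCast.mpr h
      push_cast [Nat.cast_sub (show 1 ≤ n from hn)] at this
      exact this
    have hd : (n : ℤ) ∣ j - i := by
      have := dvd_sub hz (dvd_mul_right (n : ℤ) i)
      rwa [show ((n : ℤ) - 1) * i + j - n * i = j - i by ring] at this
    have := Int.eq_zero_of_abs_lt_dvd hd (by rw [abs_lt]; constructor <;> omega)
    omega
  rw [quasiIdem_apply_of_mem_isoComp hm,
    geom_sum_eq_zero_of_aeval_cyclotomic_eq_zero hn hζ hndvd, zero_smul]

theorem sum_quasiIdem_apply {T : Module.End R M} {ζ : R} {n : ℕ} (hn : 0 < n)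
    (hζ : aeval ζ (cyclotomic n ℤ) = 0) (m : M) :
    ∑ i ∈ Finset.range n, quasiIdem T ζ n i m = n • m := by
  simp only [quasiIdem, LinearMap.sum_apply, LinearMap.smul_apply]
  rw [Finset.sum_comm, Finset.sum_eq_single_of_mem 0 (Finset.mem_range.mpr hn)]
  · simp
  · intro j hj hj0
    have hndvd : ¬ n ∣ (n - 1) * j := by
      intro h
      have hcop : Nat.Coprime n (n - 1) := by
        obtain ⟨k, rfl⟩ := Nat.exists_eq_succ_of_ne_zero hn.ne'
        simp
      exact hj0 (Nat.eq_zero_of_dvd_of_lt (hcop.dvd_of_dvd_mul_left h) (Finset.mem_range.mp hj))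
    rw [← Finset.sum_smul]
    have h := geom_sum_eq_zero_of_aeval_cyclotomic_eq_zero hn hζ hndvd
    rw [Finset.sum_congr rfl fun i _ => show ζ ^ ((n - 1) * (i * j)) = (ζ ^ ((n - 1) * j)) ^ i by
      rw [← pow_mul]; congr 1; ring, h, zero_smul]

theorem range_quasiIdem_eq_isoComp [Finite M] {T : Module.End R M} {ζ : R} {n : ℕ} (hn : 0 < n)
    (hζ : ζ ^ n = 1) (hT : T ^ n = 1) (htor : ∀ m : M, n • m = 0 → m = 0) (i : ℕ) :
    LinearMap.range (quasiIdem T ζ n i) = isoComp T ζ i := by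
  refine le_antisymm ?_ fun m hm => ?_
  · rintro _ ⟨m, rfl⟩
    exact quasiIdem_apply_mem_isoComp hn hζ hT i m
  · have hinj : Function.Injective (nsmulAddMonoidHom n : isoComp T ζ i →+ isoComp T ζ i) := by
      refine (injective_iff_map_eq_zero _).mpr fun x hx => Subtype.ext (htor _ ?_)
      exact congrArg Subtype.val hx
    obtain ⟨y, hy⟩ := Finite.surjective_of_injective hinj ⟨m, hm⟩
    exact ⟨y, (quasiIdem_apply_of_mem_isoComp_self hn hζ y.2).trans (congrArg Subtype.val hy)⟩

theorem card_eq_prod_card_isoComp [Finite M] {T : Module.End R M} {ζ : R} {n : ℕ} (hn : 0 < n)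
    (hζ : aeval ζ (cyclotomic n ℤ) = 0) (hT : T ^ n = 1)
    (htor : ∀ m : M, n • m = 0 → m = 0) :
    Nat.card M = ∏ i ∈ Finset.range n, Nat.card (isoComp T ζ i) := by
  have hpow := pow_eq_one_of_aeval_cyclotomic_eq_zero hζ
  rw [Finset.prod_range (fun i => Nat.card (isoComp T ζ i)), ← Nat.card_pi]
  refine le_antisymm ?_ ?_
  · let f : M →ₗ[R] ∀ i : Fin n, isoComp T ζ i := LinearMap.pi fun i =>
      (quasiIdem T ζ n i).codRestrict _ (quasiIdem_apply_mem_isoComp hn hpow hT i)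
    refine Nat.card_le_card_of_injective f ((injective_iff_map_eq_zero f).mpr fun m hm => ?_)
    refine htor m ?_
    rw [← sum_quasiIdem_apply (T := T) hn hζ m]
    refine Finset.sum_eq_zero fun i hi => ?_
    exact congrArg Subtype.val (congrFun hm ⟨i, Finset.mem_range.mp hi⟩)
  · let g : (∀ i : Fin n, isoComp T ζ i) →ₗ[R] M :=
      ∑ i : Fin n, (isoComp T ζ i).subtype ∘ₗ LinearMap.proj i
    refine Nat.card_le_card_of_injective g ((injective_iff_map_eq_zero g).mpr fun x hx => ?_)
    funext i
    refine Subtype.ext (htor _ ?_)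
    have h : quasiIdem T ζ n i (∑ j : Fin n, (x j : M)) = 0 := by
      have hsum : ∑ j : Fin n, (x j : M) = 0 := by simpa [g] using hx
      rw [hsum, map_zero]
    rwa [map_sum, Finset.sum_eq_single i (fun j _ hji =>
      quasiIdem_apply_of_mem_isoComp_of_ne hζ i.2 j.2 (fun h => hji (Fin.ext h.symm)) (x j).2)
      (fun h => absurd (Finset.mem_univ i) h),
      quasiIdem_apply_of_mem_isoComp_self hn hpow (x i).2] at h

/-- If moreover `M` has no `n`-torsion, then all the modules `Ĥ⁰_{χ^i}(G,M)` vanish and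
`[M] = ∏_i [M^{χ^i}] = ∏_i [ε_{χ^i} M]`. -/
theorem H0_eq_zero_and_order_eq_prod_of_no_torsion
    (n : ℕ) (hn : 1 ≤ n) (R : Type*) [CommRing R] (ζ : R)
    (hζ : Polynomial.aeval ζ (Polynomial.cyclotomic n ℤ) = 0)
    (M : Type*) [AddCommGroup M] [Module R M] [Finite M]
    (T : Module.End R M) (hT : T ^ n = 1)
    (htor : ∀ m : M, n • m = 0 → m = 0) :
    (∀ i ∈ Finset.range n, Subsingleton (H0chi T ζ n i)) ∧
      Nat.card M = ∏ i ∈ Finset.range n, Nat.card (isoComp T ζ i) ∧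
      Nat.card M = ∏ i ∈ Finset.range n, Nat.card (LinearMap.range (quasiIdem T ζ n i)) := by
  have hpow := pow_eq_one_of_aeval_cyclotomic_eq_zero hζ
  have hrange := range_quasiIdem_eq_isoComp hn hpow hT htor
  have hcard := card_eq_prod_card_isoComp hn hζ hT htor
  refine ⟨fun i _ => ?_, hcard, ?_⟩
  · rw [Submodule.Quotient.subsingleton_iff, hrange, Submodule.comap_subtype_self]
  · simpa only [hrange] using hcard
end
end

section
/- Let K/F be a finite abelian extension of number fields of exponent 2 (every element of G = Gal(K/F) has square equal to the identity). Then there exist nonnegative integers u and v such that 2^u · h_K = 2^v · h_F · ∏_{χ ≠ 1} [ε_χ C_K], where the product extends over all nontrivial characters χ : G → {±1}; equivalently, there is an integer t with 2^t · h_K/h_F = ∏_{χ ≠ 1} [ε_χ C_K]. -/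
open NumberField
open scoped nonZeroDivisors

theorem AddGroup.exists_card_eq_pow_of_pow_nsmul_eq_zero {p : ℕ} [Fact p.Prime] {k : ℕ}
    {A : Type*} [AddGroup A] [Finite A] (h : ∀ a : A, p ^ k • a = 0) :
    ∃ m, Nat.card A = p ^ m :=
  IsPGroup.iff_card (G := Multiplicative A).mp fun a ↦ ⟨k, h a.toAdd⟩

theorem AddMonoidHom.exists_pow_mul_card_eq_pow_mul_card {p : ℕ} [Fact p.Prime] {j k : ℕ}
    {A B : Type*} [AddCommGroup A] [AddCommGroup B] [Finite A] [Finite B] (f : A →+ B)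
    (hker : ∀ a, f a = 0 → p ^ j • a = 0) (hcoker : ∀ b, ∃ a, f a = p ^ k • b) :
    ∃ u v : ℕ, p ^ u * Nat.card A = p ^ v * Nat.card B := by
  obtain ⟨v, hv⟩ := AddGroup.exists_card_eq_pow_of_pow_nsmul_eq_zero (p := p) (k := j)
    (A := f.ker) fun a ↦ Subtype.ext (hker a a.2)
  obtain ⟨u, hu⟩ := AddGroup.exists_card_eq_pow_of_pow_nsmul_eq_zero (p := p) (k := k)
    (A := B ⧸ f.range) fun b ↦ by
      induction b using QuotientAddGroup.induction_on with
      | H b =>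
        rw [← QuotientAddGroup.mk_nsmul]
        exact (QuotientAddGroup.eq_zero_iff _).mpr (hcoker b)
  refine ⟨u, v, ?_⟩
  rw [AddSubgroup.card_eq_card_quotient_mul_card_addSubgroup f.range,
    AddSubgroup.card_eq_card_quotient_mul_card_addSubgroup f.ker, ← hu, ← hv,
    Nat.card_congr (QuotientAddGroup.quotientKerEquivRange f).toEquiv]
  ring

instance Int.hasEnoughRootsOfUnity_two : HasEnoughRootsOfUnity ℤ 2 where
  prim := ⟨-1, IsPrimitiveRoot.neg_one 0 (by norm_num)⟩
  cyc := inferInstance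

section characters

variable {G : Type*} [Group G]

theorem MonoidHom.int_mul_self (hexp : ∀ σ : G, σ * σ = 1) (χ : G →* ℤ) : χ * χ = 1 := by
  ext σ
  rw [MonoidHom.mul_apply, ← map_mul, hexp, map_one, MonoidHom.one_apply]

theorem MonoidHom.int_eq_one_or_neg_one (hexp : ∀ σ : G, σ * σ = 1) (χ : G →* ℤ) (σ : G) :
    χ σ = 1 ∨ χ σ = -1 :=
  mul_self_eq_one_iff.mp (DFunLike.congr_fun (χ.int_mul_self hexp) σ)

theorem exists_card_eq_two_pow_of_mul_self_eq_one [Finite G] (hexp : ∀ σ : G, σ * σ = 1) :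
    ∃ k, Nat.card G = 2 ^ k :=
  IsPGroup.iff_card.mp fun σ ↦ ⟨1, by rw [pow_one, sq, hexp]⟩

theorem hasEnoughRootsOfUnity_int_exponent (hexp : ∀ σ : G, σ * σ = 1) :
    HasEnoughRootsOfUnity ℤ (Monoid.exponent G) :=
  .of_dvd ℤ (Monoid.exponent_dvd_of_forall_pow_eq_one (n := 2) fun σ ↦ by rw [sq, hexp])

/-- A group all of whose elements square to `1` is commutative. -/
abbrev CommGroup.ofMulSelfEqOne (hexp : ∀ σ : G, σ * σ = 1) : CommGroup G where
  mul_comm a b := by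
    simp only [mul_eq_one_iff_eq_inv] at hexp
    rw [hexp (a * b), mul_inv_rev, ← hexp, ← hexp]

/-- Homomorphisms from a group to a monoid correspond to homomorphisms to its units. -/
def MonoidHom.unitsEquiv (M : Type*) [Monoid M] : (G →* Mˣ) ≃ (G →* M) where
  toFun χ := (Units.coeHom M).comp χ
  invFun := MonoidHom.toHomUnits
  left_inv χ := by ext; rfl
  right_inv χ := by ext; rfl

theorem card_monoidHom_int [Finite G] (hexp : ∀ σ : G, σ * σ = 1) :
    Nat.card (G →* ℤ) = Nat.card G := by
  have := hasEnoughRootsOfUnity_int_exponent hexp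
  let := CommGroup.ofMulSelfEqOne hexp
  rw [← CommGroup.card_monoidHom_of_hasEnoughRootsOfUnity G ℤ]
  exact Nat.card_congr (MonoidHom.unitsEquiv ℤ).symm

theorem sum_monoidHom_int_apply [Finite G] [Fintype (G →* ℤ)] (hexp : ∀ σ : G, σ * σ = 1)
    {σ : G} (hσ : σ ≠ 1) : ∑ χ : G →* ℤ, χ σ = 0 := by
  have := hasEnoughRootsOfUnity_int_exponent hexp
  let := CommGroup.ofMulSelfEqOne hexp
  obtain ⟨φ, hφ⟩ := CommGroup.exists_apply_ne_one_of_hasEnoughRootsOfUnity G ℤ hσ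
  set ψ : G →* ℤ := (Units.coeHom ℤ).comp φ
  have hψ : ψ σ = -1 := (ψ.int_eq_one_or_neg_one hexp σ).resolve_left fun h ↦ hφ (Units.ext h)
  have hinv : Function.Involutive (ψ * · : (G →* ℤ) → (G →* ℤ)) := fun χ ↦ by
    simp only [← mul_assoc, ψ.int_mul_self hexp, one_mul]
  have h := hinv.bijective.sum_comp fun χ : G →* ℤ ↦ χ σ
  simp only [MonoidHom.mul_apply, hψ, neg_one_mul, Finset.sum_neg_distrib] at h
  lia

variable [Fintype G] {A : Type*} [AddCommGroup A] [DistribMulAction G A]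

/-- The endomorphism `a ↦ ∑ σ, χ σ • σ • a` attached to an integral character `χ`. -/
def charSum (χ : G →* ℤ) : A →+ A := ∑ σ : G, χ σ • DistribSMul.toAddMonoidHom A σ

theorem charSum_apply (χ : G →* ℤ) (a : A) : charSum χ a = ∑ σ : G, χ σ • σ • a := by
  simp [charSum]

theorem smul_charSum (hexp : ∀ σ : G, σ * σ = 1) (χ : G →* ℤ) (τ : G) (a : A) :
    τ • charSum χ a = χ τ • charSum χ a := by
  simp only [charSum_apply, Finset.smul_sum]
  rw [← (Group.mulLeft_bijective τ).sum_comp fun σ ↦ χ τ • χ σ • σ • a]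
  refine Finset.sum_congr rfl fun σ _ ↦ ?_
  rw [smul_smul (χ τ), map_mul, ← mul_assoc, ← map_mul, hexp, map_one, one_mul, mul_smul,
    smul_comm τ]

theorem charSum_charSum (hexp : ∀ σ : G, σ * σ = 1) (χ ψ : G →* ℤ) (a : A) :
    charSum ψ (charSum χ a) = (∑ σ : G, (ψ * χ) σ) • charSum χ a := by
  rw [charSum_apply ψ]
  simp only [smul_charSum hexp, smul_smul, ← Finset.sum_smul, MonoidHom.mul_apply]

theorem charSum_charSum_self (hexp : ∀ σ : G, σ * σ = 1) (χ : G →* ℤ) (a : A) :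
    charSum χ (charSum χ a) = Nat.card G • charSum χ a := by
  simp [charSum_charSum hexp, χ.int_mul_self hexp]

theorem charSum_charSum_of_ne (hexp : ∀ σ : G, σ * σ = 1) {χ ψ : G →* ℤ} (h : χ ≠ ψ) (a : A) :
    charSum ψ (charSum χ a) = 0 := by
  rw [charSum_charSum hexp, sum_hom_units_eq_zero _ fun h' ↦ h ?_, zero_smul]
  rw [← one_mul χ, ← ψ.int_mul_self hexp, mul_assoc, h', mul_one]

theorem sum_charSum [Fintype (G →* ℤ)] (hexp : ∀ σ : G, σ * σ = 1) (a : A) :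
    ∑ χ : G →* ℤ, charSum χ a = Nat.card G • a := by
  simp only [charSum_apply]
  rw [Finset.sum_comm, Fintype.sum_eq_single 1 fun σ hσ ↦ ?_]
  · rw [← card_monoidHom_int hexp, Nat.card_eq_fintype_card]
    simp
  · rw [← Finset.sum_smul, sum_monoidHom_int_apply hexp hσ, zero_smul]

theorem exists_two_pow_mul_card_eq_prod_card_range_charSum [Finite A] [Fintype (G →* ℤ)]
    (hexp : ∀ σ : G, σ * σ = 1) :
    ∃ u v : ℕ, 2 ^ u * Nat.card A =
      2 ^ v * ∏ χ : G →* ℤ, Nat.card (charSum (A := A) χ).range := by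
  obtain ⟨k, hk⟩ := exists_card_eq_two_pow_of_mul_self_eq_one hexp
  rw [← Nat.card_pi]
  refine AddMonoidHom.exists_pow_mul_card_eq_pow_mul_card (j := k) (k := k)
    (AddMonoidHom.pi fun χ ↦ (charSum χ).rangeRestrict) (fun a ha ↦ ?_) fun b ↦ ?_
  · rw [← hk, ← sum_charSum hexp]
    exact Finset.sum_eq_zero fun χ _ ↦ congr_arg Subtype.val (congr_fun ha χ)
  · choose c hc using fun χ ↦ (b χ).2
    refine ⟨∑ χ, charSum χ (c χ), funext fun χ ↦ Subtype.ext ?_⟩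
    change charSum χ (∑ ψ, charSum ψ (c ψ)) = 2 ^ k • (b χ : A)
    rw [map_sum, Fintype.sum_eq_single χ fun ψ hψ ↦ charSum_charSum_of_ne hexp hψ _,
      charSum_charSum_self hexp, hc, hk]

end characters

section classGroup

variable (F K : Type*) [Field F] [NumberField F] [Field K] [NumberField K] [Algebra F K]

theorem NumberField.RingOfIntegers.finrank_eq : Module.finrank (𝓞 F) (𝓞 K) = Module.finrank F K :=
  (IsFractionRing.finrank_eq (𝓞 F) F (𝓞 K) K).symm

theorem ClassGroup.pow_finrank_eq_one_of_extendedHom_eq_one {c : ClassGroup (𝓞 F)}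
    (hc : ClassGroup.extendedHom (𝓞 F) (𝓞 K) c = 1) : c ^ Module.finrank F K = 1 := by
  obtain ⟨I, rfl⟩ := ClassGroup.mk0_surjective c
  rw [ClassGroup.extendedHom_mk0, ClassGroup.mk0_eq_one_iff] at hc
  obtain ⟨x, hx⟩ := hc.principal
  rw [← map_pow, ← NumberField.RingOfIntegers.finrank_eq]
  refine (ClassGroup.mk0_eq_one_iff _).mpr ⟨⟨Algebra.intNorm (𝓞 F) (𝓞 K) x, ?_⟩⟩
  rw [Ideal.submodule_span_eq] at hx ⊢
  rw [← Ideal.relNorm_singleton, ← hx]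
  exact (Ideal.relNorm_algebraMap (𝓞 K) _).symm

variable {F K} [IsGalois F K]

theorem NumberField.map_relNorm_eq_prod_map_galRestrict (I : Ideal (𝓞 K)) :
    (Ideal.relNorm (𝓞 F) I).map (algebraMap (𝓞 F) (𝓞 K)) =
      ∏ σ : K ≃ₐ[F] K, I.map (galRestrict (𝓞 F) F K (𝓞 K) σ) := by
  by_cases hI : I = ⊥
  · subst hI
    simp [Finset.prod_const, Ideal.map_bot]
  have hle : (Ideal.relNorm (𝓞 F) I).map (algebraMap (𝓞 F) (𝓞 K)) ≤
      ∏ σ : K ≃ₐ[F] K, I.map (galRestrict (𝓞 F) F K (𝓞 K) σ) := by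
    rw [Ideal.relNorm_apply, Ideal.map_span, Ideal.span_le]
    rintro _ ⟨_, ⟨x, hx, rfl⟩, rfl⟩
    have h : algebraMap (𝓞 F) (𝓞 K) (Algebra.intNorm (𝓞 F) (𝓞 K) x) =
        ∏ σ : K ≃ₐ[F] K, galRestrict (𝓞 F) F K (𝓞 K) σ x := by
      rw [prod_galRestrict_eq_norm]
      congr 1
      apply FaithfulSMul.algebraMap_injective (𝓞 F) F
      rw [Algebra.algebraMap_intNorm (L := K), IsIntegralClosure.algebraMap_mk']
    rw [h]
    exact Ideal.prod_mem_prod fun σ _ ↦ Ideal.mem_map_of_mem _ hx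
  obtain ⟨M, hM⟩ := Ideal.dvd_iff_le.mpr hle
  have hnorm := congr_arg Ideal.absNorm hM
  have hσ (σ : K ≃ₐ[F] K) :
      (I.map (galRestrict (𝓞 F) F K (𝓞 K) σ)).absNorm = I.absNorm := by
    rw [← Ideal.absNorm_relNorm (𝓞 F), Ideal.relNorm_map_algEquiv, Ideal.absNorm_relNorm]
  rw [map_mul, map_prod, Ideal.absNorm_algebraMap, Ideal.absNorm_relNorm,
    NumberField.RingOfIntegers.finrank_eq, ← IsGalois.card_aut_eq_finrank] at hnorm
  simp only [hσ, Finset.prod_const, Finset.card_univ, Nat.card_eq_fintype_card] at hnorm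
  have hM1 : M = ⊤ := Ideal.absNorm_eq_one_iff.mp <| (Nat.mul_eq_left <| pow_ne_zero _ <|
    mt Ideal.absNorm_eq_zero_iff.mp hI).mp hnorm.symm
  rw [hM, hM1, Ideal.mul_top]

/-- The image of a nonzero ideal under a Galois automorphism. -/
noncomputable def galMapIdeal (σ : K ≃ₐ[F] K) (I : (Ideal (𝓞 K))⁰) : (Ideal (𝓞 K))⁰ :=
  ⟨(I : Ideal (𝓞 K)).map (galRestrict (𝓞 F) F K (𝓞 K) σ), mem_nonZeroDivisors_iff_ne_zero.mpr <|
    (Ideal.map_eq_bot_iff_of_injective (galRestrict (𝓞 F) F K (𝓞 K) σ).injective).not.mpr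
      (mem_nonZeroDivisors_iff_ne_zero.mp I.2)⟩

/-- The maps `act σ` are those induced on ideal classes by the natural action on ideals. -/
def IsNaturalClassGroupAction
    (act : (K ≃ₐ[F] K) → (ClassGroup (𝓞 K) →* ClassGroup (𝓞 K))) : Prop :=
  ∀ (σ : K ≃ₐ[F] K) (I J : (Ideal (𝓞 K))⁰),
    Ideal.map (galRestrict (𝓞 F) F K (𝓞 K) σ) (I : Ideal (𝓞 K)) = (J : Ideal (𝓞 K)) →
      act σ (ClassGroup.mk0 I) = ClassGroup.mk0 J

variable {act : (K ≃ₐ[F] K) → (ClassGroup (𝓞 K) →* ClassGroup (𝓞 K))}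

theorem act_mk0 (hact : IsNaturalClassGroupAction act) (σ : K ≃ₐ[F] K) (I : (Ideal (𝓞 K))⁰) :
    act σ (ClassGroup.mk0 I) = ClassGroup.mk0 (galMapIdeal σ I) :=
  hact σ I _ rfl

theorem act_one (hact : IsNaturalClassGroupAction act) (c : ClassGroup (𝓞 K)) : act 1 c = c := by
  obtain ⟨I, rfl⟩ := ClassGroup.mk0_surjective c
  refine hact 1 I I ?_
  rw [map_one]
  exact Ideal.map_id _

theorem act_mul (hact : IsNaturalClassGroupAction act) (σ τ : K ≃ₐ[F] K) (c : ClassGroup (𝓞 K)) :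
    act (σ * τ) c = act σ (act τ c) := by
  obtain ⟨I, rfl⟩ := ClassGroup.mk0_surjective c
  rw [act_mk0 hact τ, act_mk0 hact σ]
  refine hact _ _ _ ?_
  rw [map_mul]
  exact (Ideal.map_mapₐ (galRestrict (𝓞 F) F K (𝓞 K) τ).toAlgHom
    (galRestrict (𝓞 F) F K (𝓞 K) σ).toAlgHom).symm

theorem act_extendedHom (hact : IsNaturalClassGroupAction act) (σ : K ≃ₐ[F] K)
    (c : ClassGroup (𝓞 F)) :
    act σ (ClassGroup.extendedHom (𝓞 F) (𝓞 K) c) = ClassGroup.extendedHom (𝓞 F) (𝓞 K) c := by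
  obtain ⟨I, rfl⟩ := ClassGroup.mk0_surjective c
  rw [ClassGroup.extendedHom_mk0]
  refine hact _ _ _ ?_
  refine (Ideal.map_map (algebraMap (𝓞 F) (𝓞 K))
    (galRestrict (𝓞 F) F K (𝓞 K) σ).toAlgHom.toRingHom).trans ?_
  exact congr_arg (Ideal.map · (I : Ideal (𝓞 F))) (AlgHom.comp_algebraMap _)

theorem exists_extendedHom_eq_prod_act (hact : IsNaturalClassGroupAction act)
    (c : ClassGroup (𝓞 K)) :
    ∃ b, ClassGroup.extendedHom (𝓞 F) (𝓞 K) b = ∏ σ, act σ c := by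
  obtain ⟨I, rfl⟩ := ClassGroup.mk0_surjective c
  have hI : Ideal.relNorm (𝓞 F) (I : Ideal (𝓞 K)) ∈ (Ideal (𝓞 F))⁰ :=
    mem_nonZeroDivisors_iff_ne_zero.mpr fun h ↦
      mem_nonZeroDivisors_iff_ne_zero.mp I.2 (Ideal.relNorm_eq_bot_iff.mp h)
  have h : ClassGroup.extendedIdeal (𝓞 F) (𝓞 K) ⟨_, hI⟩ = ∏ σ : K ≃ₐ[F] K, galMapIdeal σ I := by
    apply Subtype.ext
    rw [SubmonoidClass.coe_finsetProd]
    exact NumberField.map_relNorm_eq_prod_map_galRestrict _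
  refine ⟨ClassGroup.mk0 ⟨_, hI⟩, ?_⟩
  rw [ClassGroup.extendedHom_mk0, h, map_prod]
  exact Finset.prod_congr rfl fun σ _ ↦ (act_mk0 hact σ I).symm

/-- The class group as a module over the Galois group. -/
noncomputable abbrev classGroupAction (hact : IsNaturalClassGroupAction act) :
    DistribMulAction (K ≃ₐ[F] K) (Additive (ClassGroup (𝓞 K))) where
  smul σ a := MonoidHom.toAdditive (act σ) a
  one_smul := act_one hact
  mul_smul := act_mul hact
  smul_zero σ := map_zero (MonoidHom.toAdditive (act σ))
  smul_add σ := map_add (MonoidHom.toAdditive (act σ))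

theorem exists_two_pow_mul_card_range_charSum_one (hact : IsNaturalClassGroupAction act)
    (hexp : ∀ σ : K ≃ₐ[F] K, σ * σ = 1) :
    let := classGroupAction hact
    ∃ u v : ℕ, 2 ^ u * Nat.card (ClassGroup (𝓞 F)) =
      2 ^ v * Nat.card (charSum (A := Additive (ClassGroup (𝓞 K)))
        (1 : (K ≃ₐ[F] K) →* ℤ)).range := by
  intro
  obtain ⟨k, hk⟩ := exists_card_eq_two_pow_of_mul_self_eq_one hexp
  let ι := MonoidHom.toAdditive (ClassGroup.extendedHom (𝓞 F) (𝓞 K))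
  have hι (c) : charSum (1 : (K ≃ₐ[F] K) →* ℤ) (ι c) = 2 ^ k • ι c := by
    have h (σ : K ≃ₐ[F] K) : σ • ι c = ι c := act_extendedHom hact σ c
    simp only [charSum_apply, h, MonoidHom.one_apply, one_smul, Finset.sum_const,
      Finset.card_univ, ← hk, Nat.card_eq_fintype_card]
  refine AddMonoidHom.exists_pow_mul_card_eq_pow_mul_card (j := k + k) (k := k)
    (A := Additive (ClassGroup (𝓞 F))) ((charSum (1 : (K ≃ₐ[F] K) →* ℤ)).rangeRestrict.comp ι)
    (fun c hc ↦ ?_) ?_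
  · have h : ι (2 ^ k • c) = 0 := by
      rw [map_nsmul, ← hι]
      exact congr_arg Subtype.val hc
    rw [pow_add, mul_smul, ← hk, IsGalois.card_aut_eq_finrank] at *
    exact ClassGroup.pow_finrank_eq_one_of_extendedHom_eq_one F K h
  · rintro ⟨_, a, rfl⟩
    obtain ⟨b, hb⟩ := exists_extendedHom_eq_prod_act hact a.toMul
    have hb' : ι (.ofMul b) = charSum (1 : (K ≃ₐ[F] K) →* ℤ) a := by
      rw [charSum_apply]
      simp only [MonoidHom.one_apply, one_smul]
      exact hb
    refine ⟨.ofMul b, Subtype.ext ?_⟩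
    change charSum (1 : (K ≃ₐ[F] K) →* ℤ) (ι (.ofMul b)) =
      2 ^ k • charSum (1 : (K ≃ₐ[F] K) →* ℤ) a
    rw [hι, hb']

end classGroup

/-- **Corollary 6.2 (Theorem 0.8).** Let `K/F` be a finite abelian extension of number fields
of exponent `2`, and let `G = Gal(K/F)` act on the ideal class group `C_K` through its
natural action on ideals (the homomorphisms `act σ` being pinned down by their effect on
classes of ideals).  Then there exist nonnegative integers `u, v` such that
`2^u ⬝ h_K = 2^v ⬝ h_F ⬝ ∏_{χ ≠ 1} [ε_χ C_K]`, the product running over the nontrivial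
characters `χ : G → {±1}`, where `ε_χ C_K` is the image of `C_K` under
`c ↦ ∑_{σ ∈ G} χ(σ) (σ • c)`. -/
theorem exists_two_pow_mul_classNumber_eq_prod_eps
    (F K : Type*) [Field F] [NumberField F] [Field K] [NumberField K]
    [Algebra F K] [IsGalois F K]
    (hexp : ∀ σ : K ≃ₐ[F] K, σ * σ = 1)
    (act : (K ≃ₐ[F] K) → (ClassGroup (𝓞 K) →* ClassGroup (𝓞 K)))
    (hact : ∀ (σ : K ≃ₐ[F] K) (I J : (Ideal (𝓞 K))⁰),
      Ideal.map (galRestrict (𝓞 F) F K (𝓞 K) σ) (I : Ideal (𝓞 K)) = (J : Ideal (𝓞 K)) →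
        act σ (ClassGroup.mk0 I) = ClassGroup.mk0 J) :
    ∃ u v : ℕ,
      2 ^ u * Nat.card (ClassGroup (𝓞 K)) =
        2 ^ v * Nat.card (ClassGroup (𝓞 F)) *
          ∏ᶠ (χ : (K ≃ₐ[F] K) →* ℤ)
            (_ : (∀ σ, χ σ = 1 ∨ χ σ = -1) ∧ χ ≠ 1),
            Nat.card
              (AddMonoidHom.range
                (∑ᶠ σ : K ≃ₐ[F] K,
                  χ σ • MonoidHom.toAdditive (act σ))) := by
  classical
  let := classGroupAction hact
  have : Finite ((K ≃ₐ[F] K) →* ℤ) := .of_equiv _ (MonoidHom.unitsEquiv ℤ)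
  let : Fintype ((K ≃ₐ[F] K) →* ℤ) := .ofFinite _
  have hP (χ : (K ≃ₐ[F] K) →* ℤ) : ((∀ σ, χ σ = 1 ∨ χ σ = -1) ∧ χ ≠ 1) ↔ χ ≠ 1 :=
    and_iff_right (χ.int_eq_one_or_neg_one hexp)
  have hsum (χ : (K ≃ₐ[F] K) →* ℤ) :
      ∑ᶠ σ : K ≃ₐ[F] K, χ σ • MonoidHom.toAdditive (act σ) = charSum χ :=
    finsum_eq_sum_of_fintype _
  simp only [hP, hsum]
  obtain ⟨u, v, h⟩ := exists_two_pow_mul_card_range_charSum_one hact hexp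
  obtain ⟨u', v', h'⟩ := exists_two_pow_mul_card_eq_prod_card_range_charSum
    (A := Additive (ClassGroup (𝓞 K))) hexp
  rw [← finprod_eq_prod_of_fintype, ← mul_finprod_cond_ne 1 (Set.toFinite _)] at h'
  refine ⟨v + u', v' + u, ?_⟩
  calc 2 ^ (v + u') * Nat.card (ClassGroup (𝓞 K))
      = 2 ^ v * (2 ^ u' * Nat.card (Additive (ClassGroup (𝓞 K)))) := by
        rw [pow_add, mul_assoc]; rfl
    _ = _ := by
        rw [h', pow_add, mul_assoc, mul_assoc, ← mul_assoc (2 ^ u), h]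
        ring
end
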